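/- Let n ≥ 2 and let σ denote the surface measure on the unit sphere S^{n−1} ⊂ ℝⁿ. Then there exists a constant C > 0 such that for every ξ ∈ ℝⁿ, |∫_{S^{n−1}} exp(i⟨ω, ξ⟩) dσ(ω)| ≤ C (1 + ‖ξ‖)^{−(n−1)/2}; i.e. the Fourier transform of the sphere's surface measure decays at rate ‖ξ‖^{−(n−1)/2} at infinity. -/

import Mathlib

open MeasureTheory Metric Set
open scoped RealInnerProductSpace

/-- Differentiation under the integral sign over a compact space with a finite measure. -/
theorem hasDerivAt_integral_compact {X : Type*} [TopologicalSpace X] [CompactSpace X]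
    [MeasurableSpace X] [OpensMeasurableSpace X] [SecondCountableTopology X]
    (μ : Measure X) [IsFiniteMeasure μ]
    (F F' : ℝ → X → ℝ) (hF : Continuous (Function.uncurry F))
    (hF' : Continuous (Function.uncurry F'))
    (hd : ∀ t x, HasDerivAt (fun s => F s x) (F' t x) t) (t : ℝ) :
    HasDerivAt (fun s => ∫ x, F s x ∂μ) (∫ x, F' t x ∂μ) t := by
  have hc : ∀ s, Continuous (F s) := fun s => hF.comp (by fun_prop : Continuous fun x => (s, x))
  have hc' : ∀ s, Continuous (F' s) := fun s => hF'.comp (by fun_prop : Continuous fun x => (s, x))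
  obtain ⟨C, hC⟩ := ((isCompact_closedBall t 1).prod (isCompact_univ (X := X))).exists_bound_of_continuousOn
    hF'.continuousOn
  refine (hasDerivAt_integral_of_dominated_loc_of_deriv_le (s := closedBall t 1)
    (bound := fun _ => C) (closedBall_mem_nhds t one_pos) ?_ ?_ ?_ ?_ ?_ ?_).2
  · exact Filter.Eventually.of_forall fun s => (hc s).aestronglyMeasurable
  · exact (hc t).integrable_of_hasCompactSupport (HasCompactSupport.of_compactSpace _)
  · exact (hc' t).aestronglyMeasurable
  · exact Filter.Eventually.of_forall fun x s hs => hC (s, x) ⟨hs, mem_univ _⟩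
  · exact integrable_const _
  · exact Filter.Eventually.of_forall fun x s _ => hd s x

/-- Energy estimate for the Bessel type equation. -/
theorem bessel_energy (k : ℕ) (g g1 g2 : ℝ → ℝ)
    (h0 : ∀ r, HasDerivAt g (g1 r) r) (h1 : ∀ r, HasDerivAt g1 (g2 r) r)
    (hode : ∀ r, 0 < r → r * (g2 r + g r) + k * g1 r = 0) :
    ∃ M : ℝ, 0 ≤ M ∧ ∀ r, 1 ≤ r → r ^ k * g r ^ 2 ≤ M := by
  set m : ℝ := k / 2 with hm
  set K : ℝ := |m * (m - 1)| with hK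
  let H : ℝ → ℝ := fun r => (r ^ k * ((g1 r + m / r * g r) ^ 2 + g r ^ 2)) * Real.exp (K / r)
  have hH : ∀ r, 0 < r → HasDerivAt H
      (r ^ k * (2 * g r * (g1 r + m / r * g r) * (m * (m - 1) / r ^ 2)
        - K / r ^ 2 * ((g1 r + m / r * g r) ^ 2 + g r ^ 2)) * Real.exp (K / r)) r := by
    intro r hr
    have hr' := hr.ne'
    have a1 : HasDerivAt (fun r : ℝ => m / r) (-m / r ^ 2) r := by
      exact ((hasDerivAt_const r m).div (hasDerivAt_id r) hr').congr_deriv (by simp)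
    have a2 : HasDerivAt (fun r : ℝ => K / r) (-K / r ^ 2) r := by
      exact ((hasDerivAt_const r K).div (hasDerivAt_id r) hr').congr_deriv (by simp)
    have a3 := ((((hasDerivAt_pow k r).mul ((((h1 r).add (a1.mul (h0 r))).pow 2).add
      ((h0 r).pow 2)))).mul a2.exp)
    refine a3.congr_deriv ?_
    have e2 : g2 r = - g r - k / r * g1 r := by
      have := hode r hr
      field_simp
      linarith
    have e3 : (k : ℝ) * r ^ (k - 1) = 2 * m / r * r ^ k := by
      rcases Nat.eq_zero_or_pos k with h | h
      · simp [hm, h]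
      · obtain ⟨j, rfl⟩ := Nat.exists_eq_succ_of_ne_zero h.ne'
        simp only [hm, Nat.succ_eq_add_one, Nat.add_sub_cancel, pow_succ]
        field_simp
    have e4 : (k : ℝ) = 2 * m := by rw [hm]; ring
    simp only [Pi.add_apply, Pi.mul_apply, Pi.pow_apply, Nat.cast_ofNat, Nat.add_one_sub_one, pow_one]
    rw [e3, e2, e4]
    generalize Real.exp (K / r) = X
    generalize g1 r = p
    generalize g r = q
    field_simp
    ring
  have hanti : AntitoneOn H (Ici 1) := by
    refine antitoneOn_of_deriv_nonpos (convex_Ici 1) ?_ ?_ ?_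
    · intro r hr
      exact (hH r (lt_of_lt_of_le one_pos hr)).continuousAt.continuousWithinAt
    · intro r hr
      rw [interior_Ici] at hr
      exact (hH r (lt_trans one_pos hr)).differentiableAt.differentiableWithinAt
    · intro r hr
      rw [interior_Ici] at hr
      have hr0 : 0 < r := lt_trans one_pos hr
      rw [(hH r hr0).deriv]
      have hle : 2 * g r * (g1 r + m / r * g r) * (m * (m - 1) / r ^ 2)
        - K / r ^ 2 * ((g1 r + m / r * g r) ^ 2 + g r ^ 2) ≤ 0 := by
        set u := g1 r + m / r * g r
        have b1 : 2 * g r * u * (m * (m - 1)) ≤ K * (u ^ 2 + g r ^ 2) := by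
          have hKa := le_abs_self (m * (m - 1))
          have hKb := neg_abs_le (m * (m - 1))
          rw [← hK] at hKa hKb
          nlinarith [mul_nonneg (sub_nonneg.2 hKa) (sq_nonneg (u - g r)),
            mul_nonneg (sub_nonneg.2 hKb) (sq_nonneg (u + g r)),
            mul_nonneg (sub_nonneg.2 hKa) (sq_nonneg (u + g r)),
            mul_nonneg (sub_nonneg.2 hKb) (sq_nonneg (u - g r))]
        have : 2 * g r * u * (m * (m - 1) / r ^ 2) - K / r ^ 2 * (u ^ 2 + g r ^ 2)
          = (2 * g r * u * (m * (m - 1)) - K * (u ^ 2 + g r ^ 2)) / r ^ 2 := by ring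
        rw [this]
        exact div_nonpos_of_nonpos_of_nonneg (by linarith) (by positivity)
      exact mul_nonpos_of_nonpos_of_nonneg
        (mul_nonpos_of_nonneg_of_nonpos (by positivity) hle) (by positivity)
  refine ⟨H 1, by positivity, fun r hr => ?_⟩
  refine le_trans ?_ (hanti (mem_Ici.2 le_rfl) hr hr)
  have hr0 : 0 < r := lt_of_lt_of_le one_pos hr
  have hexp : 1 ≤ Real.exp (K / r) := Real.one_le_exp (by positivity)
  calc r ^ k * g r ^ 2 ≤ r ^ k * ((g1 r + m / r * g r) ^ 2 + g r ^ 2) := by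
        gcongr
        nlinarith [sq_nonneg (g1 r + m / r * g r)]
    _ ≤ H r := le_mul_of_one_le_right (by positivity) hexp

section sphere
variable {n : ℕ}

/-- The map induced on the sphere by a linear isometry. -/
noncomputable def sphMap (L : EuclideanSpace ℝ (Fin n) ≃ₗᵢ[ℝ] EuclideanSpace ℝ (Fin n))
    (ω : sphere (0 : EuclideanSpace ℝ (Fin n)) 1) : sphere (0 : EuclideanSpace ℝ (Fin n)) 1 :=
  ⟨L ω, by simp⟩

theorem sphMap_continuous (L : EuclideanSpace ℝ (Fin n) ≃ₗᵢ[ℝ] EuclideanSpace ℝ (Fin n)) :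
    Continuous (sphMap L) :=
  (L.continuous.comp continuous_subtype_val).subtype_mk _

theorem sphMap_measurePreserving
    (L : EuclideanSpace ℝ (Fin n) ≃ₗᵢ[ℝ] EuclideanSpace ℝ (Fin n)) :
    MeasurePreserving (sphMap L) (volume : Measure (EuclideanSpace ℝ (Fin n))).toSphere
      (volume : Measure (EuclideanSpace ℝ (Fin n))).toSphere := by
  have hmeas := (sphMap_continuous L).measurable
  refine ⟨hmeas, Measure.ext fun s hs => ?_⟩
  rw [Measure.map_apply hmeas hs, Measure.toSphere_apply' _ hs,
    Measure.toSphere_apply' _ (hmeas hs)]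
  congr 1
  refine Eq.trans ?_ (L.measurePreserving.measure_preimage_equiv (f := L.toMeasurableEquiv) _)
  congr 1
  ext x
  simp only [Set.mem_smul, mem_image, mem_preimage]
  constructor
  · rintro ⟨t, ht, _, ⟨ω, hω, rfl⟩, rfl⟩
    exact ⟨t, ht, _, ⟨_, hω, rfl⟩, by simp [sphMap]⟩
  · rintro ⟨t, ht, _, ⟨ω, hω, rfl⟩, hx⟩
    refine ⟨t, ht, L.symm ω, ⟨sphMap L.symm ω, ?_, rfl⟩, ?_⟩
    · have : sphMap L (sphMap L.symm ω) = ω := by ext1; simp [sphMap]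
      simpa [this] using hω
    · apply L.injective
      simpa using hx

/-- Radiality. -/
theorem radial (f : ℝ → ℝ) (hf : Continuous f) (ξ η : EuclideanSpace ℝ (Fin n))
    (h : ‖ξ‖ = ‖η‖) :
    ∫ ω : sphere (0 : EuclideanSpace ℝ (Fin n)) 1, f ⟪(ω : EuclideanSpace ℝ (Fin n)), ξ⟫
      ∂((volume : Measure (EuclideanSpace ℝ (Fin n))).toSphere) =
    ∫ ω : sphere (0 : EuclideanSpace ℝ (Fin n)) 1, f ⟪(ω : EuclideanSpace ℝ (Fin n)), η⟫
      ∂((volume : Measure (EuclideanSpace ℝ (Fin n))).toSphere) := by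
  let L := Submodule.reflection (ℝ ∙ (ξ - η))ᗮ
  have hL : L ξ = η := Submodule.reflection_sub h
  have hmp := sphMap_measurePreserving L
  have hc : Continuous fun ω : sphere (0 : EuclideanSpace ℝ (Fin n)) 1 =>
    f ⟪(ω : EuclideanSpace ℝ (Fin n)), η⟫ := by fun_prop
  have := integral_map (μ := (volume : Measure (EuclideanSpace ℝ (Fin n))).toSphere)
    hmp.measurable.aemeasurable hc.aestronglyMeasurable
  rw [hmp.map_eq] at this
  rw [this]
  refine integral_congr_ae (Filter.Eventually.of_forall fun ω => ?_)
  simp only [sphMap, ← hL, L.inner_map_map]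

/-- Integration by parts on the sphere, from radiality. -/
theorem sphere_parts (a r : ℝ) (hr : 0 < r) (e f : EuclideanSpace ℝ (Fin n))
    (he : ‖e‖ = 1) (hf : ‖f‖ = 1) (hef : ⟪e, f⟫ = 0) :
    r * ∫ ω : sphere (0 : EuclideanSpace ℝ (Fin n)) 1,
        ⟪(ω : EuclideanSpace ℝ (Fin n)), f⟫ ^ 2 * Real.cos (r * ⟪(ω : EuclideanSpace ℝ (Fin n)), e⟫ + a)
      ∂((volume : Measure (EuclideanSpace ℝ (Fin n))).toSphere) =
    - ∫ ω : sphere (0 : EuclideanSpace ℝ (Fin n)) 1,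
        -(⟪(ω : EuclideanSpace ℝ (Fin n)), e⟫ * Real.sin (r * ⟪(ω : EuclideanSpace ℝ (Fin n)), e⟫ + a))
      ∂((volume : Measure (EuclideanSpace ℝ (Fin n))).toSphere) := by
  set σ := (volume : Measure (EuclideanSpace ℝ (Fin n))).toSphere
  let x : sphere (0 : EuclideanSpace ℝ (Fin n)) 1 → ℝ := fun ω => ⟪(ω : EuclideanSpace ℝ (Fin n)), e⟫
  let y : sphere (0 : EuclideanSpace ℝ (Fin n)) 1 → ℝ := fun ω => ⟪(ω : EuclideanSpace ℝ (Fin n)), f⟫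
  have hx : Continuous x := by fun_prop
  have hy : Continuous y := by fun_prop
  let A : ℝ → _ → ℝ := fun θ ω => Real.cos (r * (Real.cos θ * x ω + Real.sin θ * y ω) + a)
  let B : ℝ → _ → ℝ := fun θ ω => -Real.sin (r * (Real.cos θ * x ω + Real.sin θ * y ω) + a) *
    (r * (-Real.sin θ * x ω + Real.cos θ * y ω))
  let D : ℝ → _ → ℝ := fun θ ω => -(Real.cos (r * (Real.cos θ * x ω + Real.sin θ * y ω) + a) *
    (r * (-Real.sin θ * x ω + Real.cos θ * y ω))) * (r * (-Real.sin θ * x ω + Real.cos θ * y ω))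
    + -Real.sin (r * (Real.cos θ * x ω + Real.sin θ * y ω) + a) *
    (r * (-Real.cos θ * x ω + -Real.sin θ * y ω))
  have hp : ∀ θ ω, HasDerivAt (fun θ => r * (Real.cos θ * x ω + Real.sin θ * y ω) + a)
      (r * (-Real.sin θ * x ω + Real.cos θ * y ω)) θ := fun θ ω =>
    (((((Real.hasDerivAt_cos θ).mul_const (x ω)).add
      ((Real.hasDerivAt_sin θ).mul_const (y ω))).const_mul r).add_const a)
  have hq : ∀ θ ω, HasDerivAt (fun θ => r * (-Real.sin θ * x ω + Real.cos θ * y ω))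
      (r * (-Real.cos θ * x ω + -Real.sin θ * y ω)) θ := fun θ ω =>
    (((((Real.hasDerivAt_sin θ).neg.mul_const (x ω)).add
      ((Real.hasDerivAt_cos θ).mul_const (y ω))).const_mul r))
  have hA : ∀ θ ω, HasDerivAt (fun θ => A θ ω) (B θ ω) θ := fun θ ω => (hp θ ω).cos
  have hB : ∀ θ ω, HasDerivAt (fun θ => B θ ω) (D θ ω) θ := fun θ ω =>
    ((hp θ ω).sin.neg).mul (hq θ ω)
  have cA : Continuous (Function.uncurry A) := by simp only [A, Function.uncurry_def]; fun_prop
  have cB : Continuous (Function.uncurry B) := by simp only [B, Function.uncurry_def]; fun_prop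
  have cD : Continuous (Function.uncurry D) := by simp only [D, Function.uncurry_def]; fun_prop
  have iA := hasDerivAt_integral_compact σ A B cA cB hA
  have iB := hasDerivAt_integral_compact σ B D cB cD hB
  have constA : ∀ θ, ∫ ω, A θ ω ∂σ = ∫ ω, A 0 ω ∂σ := by
    intro θ
    have hn : ∀ θ : ℝ, ‖r • (Real.cos θ • e + Real.sin θ • f)‖ = r := by
      intro θ
      have : ‖Real.cos θ • e + Real.sin θ • f‖ ^ 2 = 1 := by
        rw [@norm_add_sq_real, norm_smul, norm_smul, inner_smul_left, inner_smul_right, hef, he, hf]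
        simp
      have h1 : ‖Real.cos θ • e + Real.sin θ • f‖ = 1 := by
        exact (pow_eq_one_iff_of_nonneg (norm_nonneg _) two_ne_zero).1 this
      rw [norm_smul, h1, Real.norm_of_nonneg hr.le, mul_one]
    have := radial (fun t => Real.cos (t + a)) (by fun_prop) (r • (Real.cos θ • e + Real.sin θ • f))
      (r • (Real.cos 0 • e + Real.sin 0 • f)) ((hn θ).trans (hn 0).symm)
    simpa only [inner_smul_right, inner_add_right] using this
  have zeroB : ∀ θ, ∫ ω, B θ ω ∂σ = 0 := by
    intro θ
    have h1 := iA θ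
    rw [funext constA] at h1
    exact h1.unique (hasDerivAt_const θ _)
  have zeroD : ∫ ω, D 0 ω ∂σ = 0 := by
    have h1 := iB 0
    rw [funext zeroB] at h1
    exact h1.unique (hasDerivAt_const _ _)
  have int1 : Integrable (fun ω => y ω ^ 2 * Real.cos (r * x ω + a)) σ :=
    (by fun_prop : Continuous _).integrable_of_hasCompactSupport (HasCompactSupport.of_compactSpace _)
  have int2 : Integrable (fun ω => -(x ω * Real.sin (r * x ω + a))) σ :=
    (by fun_prop : Continuous _).integrable_of_hasCompactSupport (HasCompactSupport.of_compactSpace _)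
  have hD : ∫ ω, D 0 ω ∂σ = -r ^ 2 * ∫ ω, y ω ^ 2 * Real.cos (r * x ω + a) ∂σ
      + -r * ∫ ω, -(x ω * Real.sin (r * x ω + a)) ∂σ := by
    rw [← integral_const_mul, ← integral_const_mul,
      ← integral_add (int1.const_mul _) (int2.const_mul _)]
    refine integral_congr_ae (Filter.Eventually.of_forall fun ω => ?_)
    simp [D]
    ring
  rw [zeroD] at hD
  change r * ∫ ω, y ω ^ 2 * Real.cos (r * x ω + a) ∂σ =
    - ∫ ω, -(x ω * Real.sin (r * x ω + a)) ∂σ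
  have : r * (r * ∫ ω, y ω ^ 2 * Real.cos (r * x ω + a) ∂σ) =
    r * (- ∫ ω, -(x ω * Real.sin (r * x ω + a)) ∂σ) := by linarith
  exact mul_left_cancel₀ hr.ne' this

theorem sphere_real_decay (hn : 2 ≤ n) (a : ℝ) :
    ∃ M : ℝ, 0 ≤ M ∧ ∀ ξ : EuclideanSpace ℝ (Fin n), 1 ≤ ‖ξ‖ →
      ‖ξ‖ ^ (n - 1) * (∫ ω : sphere (0 : EuclideanSpace ℝ (Fin n)) 1,
        Real.cos (⟪(ω : EuclideanSpace ℝ (Fin n)), ξ⟫ + a)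
      ∂((volume : Measure (EuclideanSpace ℝ (Fin n))).toSphere)) ^ 2 ≤ M := by
  set σ := (volume : Measure (EuclideanSpace ℝ (Fin n))).toSphere
  let b := EuclideanSpace.basisFun (Fin n) ℝ
  let i0 : Fin n := ⟨0, by omega⟩
  let x : sphere (0 : EuclideanSpace ℝ (Fin n)) 1 → ℝ :=
    fun ω => ⟪(ω : EuclideanSpace ℝ (Fin n)), b i0⟫
  have hx : Continuous x := by fun_prop
  let A : ℝ → _ → ℝ := fun r ω => Real.cos (r * x ω + a)
  let B : ℝ → _ → ℝ := fun r ω => -(x ω * Real.sin (r * x ω + a))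
  let D : ℝ → _ → ℝ := fun r ω => -(x ω * (x ω * Real.cos (r * x ω + a)))
  have hp : ∀ r ω, HasDerivAt (fun r => r * x ω + a) (x ω) r := fun r ω => by
    simpa using ((hasDerivAt_id r).mul_const (x ω)).add_const a
  have hA : ∀ r ω, HasDerivAt (fun r => A r ω) (B r ω) r := fun r ω =>
    (hp r ω).cos.congr_deriv (by simp only [B]; ring)
  have hB : ∀ r ω, HasDerivAt (fun r => B r ω) (D r ω) r := fun r ω =>
    (((hp r ω).sin.const_mul (x ω)).neg).congr_deriv (by simp only [D]; ring)
  have cA : Continuous (Function.uncurry A) := by simp only [A, Function.uncurry_def]; fun_prop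
  have cB : Continuous (Function.uncurry B) := by simp only [B, Function.uncurry_def]; fun_prop
  have cD : Continuous (Function.uncurry D) := by simp only [D, Function.uncurry_def]; fun_prop
  have iA := hasDerivAt_integral_compact σ A B cA cB hA
  have iB := hasDerivAt_integral_compact σ B D cB cD hB
  obtain ⟨M, hM0, hM⟩ := bessel_energy (n - 1) _ _ _ iA iB (by
    intro r hr
    have hparts : ∀ j ∈ Finset.univ.erase i0,
        ∫ ω : sphere (0 : EuclideanSpace ℝ (Fin n)) 1,
        r * (⟪(ω : EuclideanSpace ℝ (Fin n)), b j⟫ ^ 2 * Real.cos (r * x ω + a)) ∂σ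
        = - ∫ ω, B r ω ∂σ := by
      intro j hj
      rw [integral_const_mul]
      exact sphere_parts a r hr (b i0) (b j) (b.orthonormal.1 _) (b.orthonormal.1 _)
        (b.orthonormal.2 (Finset.ne_of_mem_erase hj).symm)
    have hs := Finset.sum_congr rfl hparts
    have integ : ∀ h : sphere (0 : EuclideanSpace ℝ (Fin n)) 1 → ℝ, Continuous h → Integrable h σ :=
      fun h hh => hh.integrable_of_hasCompactSupport (HasCompactSupport.of_compactSpace _)
    rw [← integral_finsetSum _ (fun j _ => integ _ (by fun_prop)), Finset.sum_const,
      Finset.card_erase_of_mem (Finset.mem_univ _), Finset.card_univ, Fintype.card_fin,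
      nsmul_eq_mul] at hs
    have hsum : ∫ ω, D r ω ∂σ + ∫ ω, A r ω ∂σ = ∫ ω, (D r ω + A r ω) ∂σ :=
      (integral_add (integ _ (by simp only [D]; fun_prop)) (integ _ (by simp only [A]; fun_prop))).symm
    rw [hsum, ← integral_const_mul]
    have : ∫ ω, r * (D r ω + A r ω) ∂σ = ∫ ω : sphere (0 : EuclideanSpace ℝ (Fin n)) 1,
        ∑ j ∈ Finset.univ.erase i0,
        r * (⟪(ω : EuclideanSpace ℝ (Fin n)), b j⟫ ^ 2 * Real.cos (r * x ω + a)) ∂σ := by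
      refine integral_congr_ae (Filter.Eventually.of_forall fun ω => ?_)
      have h1 : ∑ j, ⟪(ω : EuclideanSpace ℝ (Fin n)), b j⟫ ^ 2 = 1 := by
        have := b.sum_sq_inner_left (ω : EuclideanSpace ℝ (Fin n))
        rw [this]; simp
      rw [← Finset.add_sum_erase _ _ (Finset.mem_univ i0)] at h1
      have h2 : ∑ j ∈ Finset.univ.erase i0, ⟪(ω : EuclideanSpace ℝ (Fin n)), b j⟫ ^ 2
        = 1 - x ω ^ 2 := by simp only [x]; linarith
      simp only [← Finset.mul_sum, ← Finset.sum_mul]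
      rw [h2]
      simp only [A, D]
      ring
    rw [this, hs]
    ring)
  refine ⟨M, hM0, fun ξ hξ => ?_⟩
  have h := hM ‖ξ‖ hξ
  have hrad := radial (fun t => Real.cos (t + a)) (by fun_prop) ξ (‖ξ‖ • b i0)
    (by rw [norm_smul, b.orthonormal.1 i0]; simp)
  simp only [inner_smul_right] at hrad
  rw [hrad]
  exact h

end sphere

/-- Fourier decay of the surface measure of the unit sphere `S^{n-1} ⊂ ℝⁿ`: there is `C > 0`
with `|∫_{S^{n-1}} exp(i⟨ω,ξ⟩) dσ(ω)| ≤ C (1 + ‖ξ‖)^{-(n-1)/2}` for all `ξ ∈ ℝⁿ`. -/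
theorem statement9 (n : ℕ) (hn : 2 ≤ n) :
    ∃ C > (0 : ℝ), ∀ ξ : EuclideanSpace ℝ (Fin n),
      ‖∫ ω : Metric.sphere (0 : EuclideanSpace ℝ (Fin n)) 1,
          Complex.exp (Complex.I * (⟪(ω : EuclideanSpace ℝ (Fin n)), ξ⟫ : ℝ))
          ∂((volume : Measure (EuclideanSpace ℝ (Fin n))).toSphere)‖
        ≤ C * (1 + ‖ξ‖) ^ (-(((n : ℝ) - 1) / 2)) := by
  set σ := (volume : Measure (EuclideanSpace ℝ (Fin n))).toSphere with hσ
  obtain ⟨M, hM0, hM⟩ := sphere_real_decay hn 0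
  obtain ⟨N, hN0, hN⟩ := sphere_real_decay hn (-(Real.pi / 2))
  set m : ℝ := ((n : ℝ) - 1) / 2 with hm
  have hm0 : 0 ≤ m := by
    have : (2 : ℝ) ≤ n := by exact_mod_cast hn
    rw [hm]; linarith
  set S : ℝ := σ.real univ
  have hS : 0 ≤ S := measureReal_nonneg
  refine ⟨(S + √M + √N + 1) * 2 ^ m, by positivity, fun ξ => ?_⟩
  set F := ∫ ω : Metric.sphere (0 : EuclideanSpace ℝ (Fin n)) 1,
          Complex.exp (Complex.I * (⟪(ω : EuclideanSpace ℝ (Fin n)), ξ⟫ : ℝ)) ∂σ with hF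
  have hcont : Continuous fun ω : Metric.sphere (0 : EuclideanSpace ℝ (Fin n)) 1 =>
    Complex.exp (Complex.I * (⟪(ω : EuclideanSpace ℝ (Fin n)), ξ⟫ : ℝ)) := by fun_prop
  have hintF := hcont.integrable_of_hasCompactSupport (μ := σ) (HasCompactSupport.of_compactSpace _)
  have hpos : 0 < 1 + ‖ξ‖ := by positivity
  rcases le_total ‖ξ‖ 1 with h1 | h1
  · have hb : ‖F‖ ≤ 1 * S := norm_integral_le_of_norm_le_const
      (Filter.Eventually.of_forall fun ω => by rw [mul_comm, Complex.norm_exp_ofReal_mul_I])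
    have h2 : (2 : ℝ) ^ (-m) ≤ (1 + ‖ξ‖) ^ (-m) :=
      Real.rpow_le_rpow_of_nonpos hpos (by linarith) (by linarith)
    calc ‖F‖ ≤ S + √M + √N + 1 := by linarith [Real.sqrt_nonneg M, Real.sqrt_nonneg N]
      _ = (S + √M + √N + 1) * 2 ^ m * 2 ^ (-m) := by
          rw [mul_assoc, ← Real.rpow_add two_pos]; simp
      _ ≤ _ := by gcongr
  · have hr0 : 0 < ‖ξ‖ := lt_of_lt_of_le one_pos h1
    have hre : F.re = ∫ ω : sphere (0 : EuclideanSpace ℝ (Fin n)) 1,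
        Real.cos (⟪(ω : EuclideanSpace ℝ (Fin n)), ξ⟫ + 0) ∂σ := by
      have := integral_re hintF
      simp only [RCLike.re_to_complex] at this
      rw [hF, ← this]
      refine integral_congr_ae (Filter.Eventually.of_forall fun ω => ?_)
      simp only [mul_comm Complex.I, Complex.exp_ofReal_mul_I_re, add_zero]
    have him : F.im = ∫ ω : sphere (0 : EuclideanSpace ℝ (Fin n)) 1,
        Real.cos (⟪(ω : EuclideanSpace ℝ (Fin n)), ξ⟫ + -(Real.pi / 2)) ∂σ := by
      have := integral_im hintF
      simp only [RCLike.im_to_complex] at this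
      rw [hF, ← this]
      refine integral_congr_ae (Filter.Eventually.of_forall fun ω => ?_)
      simp only [mul_comm Complex.I, Complex.exp_ofReal_mul_I_im, ← sub_eq_add_neg,
        Real.cos_sub_pi_div_two]
    have hA := hM ξ h1
    have hB := hN ξ h1
    rw [← hσ, ← hre] at hA
    rw [← hσ, ← him] at hB
    have hpw : ‖ξ‖ ^ (n - 1) = (‖ξ‖ ^ m) ^ 2 := by
      rw [← Real.rpow_natCast, ← Real.rpow_natCast, ← Real.rpow_mul hr0.le]
      congr 1
      rw [Nat.cast_sub (by omega), hm]
      push_cast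
      ring
    rw [hpw, ← mul_pow] at hA hB
    have hA' := Real.abs_le_sqrt hA
    have hB' := Real.abs_le_sqrt hB
    have hq : 0 < ‖ξ‖ ^ m := Real.rpow_pos_of_pos hr0 _
    rw [abs_mul, abs_of_pos hq] at hA' hB'
    have hFn : ‖ξ‖ ^ m * ‖F‖ ≤ √M + √N := by
      have := Complex.norm_le_abs_re_add_abs_im F
      nlinarith
    have h2 : (1 + ‖ξ‖) ^ m ≤ 2 ^ m * ‖ξ‖ ^ m := by
      rw [← Real.mul_rpow two_pos.le hr0.le]
      exact Real.rpow_le_rpow hpos.le (by linarith) hm0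
    rw [Real.rpow_neg hpos.le, ← div_eq_mul_inv, le_div_iff₀ (Real.rpow_pos_of_pos hpos _)]
    calc ‖F‖ * (1 + ‖ξ‖) ^ m ≤ ‖F‖ * (2 ^ m * ‖ξ‖ ^ m) := by gcongr
      _ = (‖ξ‖ ^ m * ‖F‖) * 2 ^ m := by ring
      _ ≤ _ := by
        gcongr
        linarith
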